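/- Suppose d is a differential on A with d(x1) = x3*x3, d(x2) = x1*x3 + x3*x1, and d(x3) = 0, and set w := x1*x1 + x2*x3 + x3*x2. Then for every n ≥ 1: ker d ∩ A_{2n−1} = (range d ∩ A_{2n−1}) + k·(x3*w^{n−1}) and x3*w^{n−1} ∉ range d; and for every n ≥ 0: ker d ∩ A_{2n} = (range d ∩ A_{2n}) + k·w^n, with w^n ∉ range d for n ≥ 1. (Equivalently, the cohomology algebra H(A, d) is isomorphic to k[⌈x3⌉, ⌈w⌉]/(⌈x3⌉²) with ⌈x3⌉ in degree 1 and ⌈w⌉ in degree 2.) -/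

import Mathlib

noncomputable section

/-- `V`, the `k`-linear span of the generators `x1, x2, x3` in the free algebra
`A = k⟨x1,x2,x3⟩`; the `m`-th graded piece of `A` is `A_m = V^m`. -/
def Vgen (k : Type*) [Field k] : Submodule k (FreeAlgebra k (Fin 3)) :=
  Submodule.span k {FreeAlgebra.ι k 0, FreeAlgebra.ι k 1, FreeAlgebra.ι k 2}

/-- A differential on `A = k⟨x1,x2,x3⟩` (making `A` a connected cochain DG algebra with
generators in degree `1`): a `k`-linear map `d : A → A` with `d(A_m) ⊆ A_{m+1}`, the graded
Leibniz rule, and `d ∘ d = 0`. -/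
def IsDGDifferential (k : Type*) [Field k]
    (d : FreeAlgebra k (Fin 3) →ₗ[k] FreeAlgebra k (Fin 3)) : Prop :=
  (∀ m : ℕ, ∀ a ∈ (Vgen k) ^ m, d a ∈ (Vgen k) ^ (m + 1)) ∧
  (∀ m : ℕ, ∀ a ∈ (Vgen k) ^ m, ∀ b : FreeAlgebra k (Fin 3),
    d (a * b) = d a * b + ((-1 : k) ^ m) • (a * d b)) ∧
  (∀ a : FreeAlgebra k (Fin 3), d (d a) = 0)

/-- The element `w = x1*x1 + x2*x3 + x3*x2` of `A = k⟨x1,x2,x3⟩`. -/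
def wElt (k : Type*) [Field k] : FreeAlgebra k (Fin 3) :=
  FreeAlgebra.ι k 0 * FreeAlgebra.ι k 0 + FreeAlgebra.ι k 1 * FreeAlgebra.ι k 2 +
    FreeAlgebra.ι k 2 * FreeAlgebra.ι k 1

namespace FreeAlgebra

open Polynomial

variable (k : Type*) [Field k]

/-- The algebra map `A → A[X]` sending each generator `x` to `x X`; it marks degrees. -/
def degreeMark : FreeAlgebra k (Fin 3) →ₐ[k] (FreeAlgebra k (Fin 3))[X] :=
  lift k fun i => monomial 1 (ι k i)

/-- The projection of `A` onto its component of degree `m`. -/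
def component (m : ℕ) : FreeAlgebra k (Fin 3) →ₗ[k] FreeAlgebra k (Fin 3) where
  toFun u := (degreeMark k u).coeff m
  map_add' := by simp
  map_smul' := by simp

/-- Left multiplication by a generator on `A`, recording in the second factor which generator was
multiplied last and what it was multiplied with. -/
def recordMul (i : Fin 3) :
    Module.End k (FreeAlgebra k (Fin 3) × (Fin 3 → FreeAlgebra k (Fin 3))) :=
  ((LinearMap.mulLeft k (ι k i)).prod (LinearMap.single k (fun _ => FreeAlgebra k (Fin 3)) i)) ∘ₗ
    LinearMap.fst k _ _

/-- The linear map removing a leading generator `ι k i` and killing words starting otherwise. -/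
def leftPart (i : Fin 3) : FreeAlgebra k (Fin 3) →ₗ[k] FreeAlgebra k (Fin 3) where
  toFun u := (lift k (recordMul k) u (1, 0)).2 i
  map_add' := by simp
  map_smul' := by simp

variable {k}

theorem lift_recordMul_fst (u : FreeAlgebra k (Fin 3)) :
    ∀ p, (lift k (recordMul k) u p).1 = u * p.1 := by
  induction u using FreeAlgebra.induction with
  | grade0 r => intro p; simp [Algebra.smul_def, Module.algebraMap_end_apply]
  | grade1 i => intro p; simp [recordMul]
  | mul a b ha hb => intro p; simp [ha, hb, mul_assoc]
  | add a b ha hb => intro p; simp [ha, hb, add_mul]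

theorem leftPart_ι_mul (i j : Fin 3) (u : FreeAlgebra k (Fin 3)) :
    leftPart k i (ι k j * u) = if i = j then u else 0 := by
  have h := lift_recordMul_fst u (1, 0)
  simp only [mul_one] at h
  simp [leftPart, recordMul, h, Pi.single_apply]

theorem ι_mul_sum_inj {p q r p' q' r' : FreeAlgebra k (Fin 3)}
    (h : ι k 2 * p + ι k 0 * q + ι k 1 * r = ι k 2 * p' + ι k 0 * q' + ι k 1 * r') :
    p = p' ∧ q = q' ∧ r = r' := by
  refine ⟨?_, ?_, ?_⟩
  · simpa [leftPart_ι_mul] using congrArg (leftPart k 2) h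
  · simpa [leftPart_ι_mul] using congrArg (leftPart k 0) h
  · simpa [leftPart_ι_mul] using congrArg (leftPart k 1) h

theorem ι_mem_Vgen (i : Fin 3) : ι k i ∈ Vgen k := by
  apply Submodule.subset_span
  fin_cases i <;> simp

theorem ι_mul_mem (i : Fin 3) {m : ℕ} {u : FreeAlgebra k (Fin 3)} (hu : u ∈ Vgen k ^ m) :
    ι k i * u ∈ Vgen k ^ (m + 1) := by
  rw [pow_succ']
  exact Submodule.mul_mem_mul (ι_mem_Vgen i) hu

theorem exists_of_mem_Vgen_pow_succ {m : ℕ} {u : FreeAlgebra k (Fin 3)}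
    (hu : u ∈ Vgen k ^ (m + 1)) :
    ∃ p ∈ Vgen k ^ m, ∃ q ∈ Vgen k ^ m, ∃ r ∈ Vgen k ^ m,
      u = ι k 2 * p + ι k 0 * q + ι k 1 * r := by
  rw [pow_succ'] at hu
  induction hu using Submodule.mul_induction_on' with
  | mem_mul_mem v hv y hy =>
    obtain ⟨α, β, γ, rfl⟩ := Submodule.mem_span_triple.mp hv
    refine ⟨γ • y, Submodule.smul_mem _ _ hy, α • y, Submodule.smul_mem _ _ hy, β • y,
      Submodule.smul_mem _ _ hy, ?_⟩
    simp only [add_mul, smul_mul_assoc, mul_smul_comm]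
    abel
  | add x hx y hy ihx ihy =>
    obtain ⟨p, hp, q, hq, r, hr, rfl⟩ := ihx
    obtain ⟨p', hp', q', hq', r', hr', rfl⟩ := ihy
    exact ⟨p + p', add_mem hp hp', q + q', add_mem hq hq', r + r', add_mem hr hr', by
      simp only [mul_add]; abel⟩

theorem degreeMark_of_mem {m : ℕ} {u : FreeAlgebra k (Fin 3)} (hu : u ∈ Vgen k ^ m) :
    degreeMark k u = monomial m u := by
  induction m generalizing u with
  | zero =>
    rw [pow_zero] at hu
    obtain ⟨c, rfl⟩ := Submodule.mem_one.mp hu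
    simp [Polynomial.algebraMap_apply]
  | succ m ih =>
    obtain ⟨p, hp, q, hq, r, hr, rfl⟩ := exists_of_mem_Vgen_pow_succ hu
    rw [map_add, map_add, map_mul, map_mul, map_mul, ih hp, ih hq, ih hr]
    simp [degreeMark, monomial_mul_monomial, add_comm 1 m]

theorem component_of_mem {m : ℕ} {u : FreeAlgebra k (Fin 3)} (hu : u ∈ Vgen k ^ m) (j : ℕ) :
    component k j u = if m = j then u else 0 := by
  simp [component, degreeMark_of_mem hu, coeff_monomial]

theorem iSup_Vgen_pow : ⨆ m, Vgen k ^ m = ⊤ := by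
  rw [← Algebra.top_toSubmodule, ← adjoin_range_ι, Algebra.adjoin_eq_span]
  refine le_antisymm ?_ (Submodule.span_le.mpr fun u hu => ?_)
  · rw [← Algebra.adjoin_eq_span, adjoin_range_ι]
    exact fun _ _ => trivial
  · suffices ∃ m, u ∈ Vgen k ^ m from this.elim fun m hm => Submodule.mem_iSup_of_mem m hm
    induction hu using Submonoid.closure_induction with
    | mem x hx =>
      obtain ⟨i, rfl⟩ := hx
      exact ⟨1, by simpa using ι_mem_Vgen i⟩
    | one => exact ⟨0, by simp⟩
    | mul x y _ _ ihx ihy =>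
      obtain ⟨m, hm⟩ := ihx
      obtain ⟨n, hn⟩ := ihy
      exact ⟨m + n, by rw [pow_add]; exact Submodule.mul_mem_mul hm hn⟩

theorem component_mem (m : ℕ) (u : FreeAlgebra k (Fin 3)) : component k m u ∈ Vgen k ^ m := by
  have hu : u ∈ ⨆ m, Vgen k ^ m := iSup_Vgen_pow (k := k) ▸ Submodule.mem_top
  induction hu using Submodule.iSup_induction' with
  | mem j x hx =>
    rw [component_of_mem hx]
    split_ifs with h
    · exact h ▸ hx
    · exact zero_mem _
  | zero => simp
  | add x y _ _ hx hy => rw [map_add]; exact add_mem hx hy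

theorem component_succ_map {d : FreeAlgebra k (Fin 3) →ₗ[k] FreeAlgebra k (Fin 3)}
    (hd : ∀ m : ℕ, ∀ a ∈ Vgen k ^ m, d a ∈ Vgen k ^ (m + 1)) (m : ℕ)
    (u : FreeAlgebra k (Fin 3)) : component k (m + 1) (d u) = d (component k m u) := by
  have hu : u ∈ ⨆ m, Vgen k ^ m := iSup_Vgen_pow (k := k) ▸ Submodule.mem_top
  induction hu using Submodule.iSup_induction' with
  | mem j x hx =>
    rw [component_of_mem hx, component_of_mem (hd j x hx)]
    by_cases h : j = m <;> simp [h]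
  | zero => simp
  | add x y _ _ hx hy => simp [hx, hy]

theorem exists_homogeneous_preimage {d : FreeAlgebra k (Fin 3) →ₗ[k] FreeAlgebra k (Fin 3)}
    (hd : ∀ m : ℕ, ∀ a ∈ Vgen k ^ m, d a ∈ Vgen k ^ (m + 1)) {m : ℕ}
    {u : FreeAlgebra k (Fin 3)} (hu : u ∈ Vgen k ^ (m + 1)) (h : u ∈ LinearMap.range d) :
    ∃ v ∈ Vgen k ^ m, d v = u := by
  obtain ⟨v, rfl⟩ := h
  exact ⟨component k m v, component_mem m v, by
    rw [← component_succ_map hd, component_of_mem hu, if_pos rfl]⟩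

theorem wElt_mem : wElt k ∈ Vgen k ^ 2 := by
  rw [pow_two]
  exact add_mem (add_mem (Submodule.mul_mem_mul (ι_mem_Vgen 0) (ι_mem_Vgen 0))
    (Submodule.mul_mem_mul (ι_mem_Vgen 1) (ι_mem_Vgen 2)))
    (Submodule.mul_mem_mul (ι_mem_Vgen 2) (ι_mem_Vgen 1))

theorem wElt_pow_mem (n : ℕ) : wElt k ^ n ∈ Vgen k ^ (2 * n) := by
  rw [pow_mul]
  exact Submodule.pow_mem_pow _ wElt_mem n

end FreeAlgebra

namespace IsDGDifferential

open FreeAlgebra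

variable {k : Type*} [Field k] {d : FreeAlgebra k (Fin 3) →ₗ[k] FreeAlgebra k (Fin 3)}

theorem map_one (hd : IsDGDifferential k d) : d 1 = 0 := by
  have h := hd.2.1 0 1 (by simp) 1
  simpa using h

theorem map_ι_mul (hd : IsDGDifferential k d) (i : Fin 3) (u : FreeAlgebra k (Fin 3)) :
    d (ι k i * u) = d (ι k i) * u - ι k i * d u := by
  rw [hd.2.1 1 (ι k i) (by simpa using ι_mem_Vgen i) u]
  simp [sub_eq_add_neg]

/-- Every cycle of degree `m` is the sum of a boundary and a multiple of `h`. -/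
def CyclesSpannedBy (d : FreeAlgebra k (Fin 3) →ₗ[k] FreeAlgebra k (Fin 3)) (m : ℕ)
    (h : FreeAlgebra k (Fin 3)) : Prop :=
  ∀ u ∈ Vgen k ^ m, d u = 0 →
    ∃ v, (∀ i, ι k i * v ∈ Vgen k ^ m) ∧ ∃ c : k, u = d v + c • h

theorem CyclesSpannedBy.of_exists (hd : IsDGDifferential k d) {m : ℕ}
    {h : FreeAlgebra k (Fin 3)} (hh : h ∈ Vgen k ^ (m + 1))
    (H : ∀ u ∈ Vgen k ^ (m + 1), d u = 0 → ∃ v, ∃ c : k, u = d v + c • h) :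
    CyclesSpannedBy d (m + 1) h := by
  intro u hu hu0
  obtain ⟨v, c, hv⟩ := H u hu hu0
  obtain ⟨v', hv', hv''⟩ := exists_homogeneous_preimage hd.1
    (u := u - c • h) (sub_mem hu (Submodule.smul_mem _ _ hh)) ⟨v, by rw [hv]; abel⟩
  exact ⟨v', fun i => ι_mul_mem i hv', c, by rw [hv'']; abel⟩

theorem CyclesSpannedBy.ker_inf_eq {m : ℕ} {h : FreeAlgebra k (Fin 3)}
    (H : CyclesSpannedBy d m h) (hd : IsDGDifferential k d) (hm : h ∈ Vgen k ^ m)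
    (h0 : d h = 0) :
    LinearMap.ker d ⊓ Vgen k ^ m = (LinearMap.range d ⊓ Vgen k ^ m) ⊔ Submodule.span k {h} := by
  apply le_antisymm
  · rintro u ⟨hu0, hu⟩
    obtain ⟨v, -, c, rfl⟩ := H u hu hu0
    refine Submodule.add_mem_sup ⟨⟨v, rfl⟩, ?_⟩
      (Submodule.smul_mem _ _ (Submodule.mem_span_singleton_self h))
    have := sub_mem hu (Submodule.smul_mem _ c hm)
    rwa [add_sub_cancel_right] at this
  · refine sup_le (inf_le_inf_right _ ?_) ?_
    · rintro _ ⟨v, rfl⟩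
      exact hd.2.2 v
    · rw [Submodule.span_singleton_le_iff_mem]
      exact ⟨h0, hm⟩

end IsDGDifferential

/-- A differential with `d x1 = x3 * x3`, `d x2 = x1 * x3 + x3 * x1` and `d x3 = 0`. -/
structure IsKoszulCYDifferential (k : Type*) [Field k]
    (d : FreeAlgebra k (Fin 3) →ₗ[k] FreeAlgebra k (Fin 3)) : Prop where
  isDG : IsDGDifferential k d
  map_ι_zero : d (FreeAlgebra.ι k 0) = FreeAlgebra.ι k 2 * FreeAlgebra.ι k 2
  map_ι_one : d (FreeAlgebra.ι k 1) =
    FreeAlgebra.ι k 0 * FreeAlgebra.ι k 2 + FreeAlgebra.ι k 2 * FreeAlgebra.ι k 0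
  map_ι_two : d (FreeAlgebra.ι k 2) = 0

namespace IsKoszulCYDifferential

open FreeAlgebra IsDGDifferential

variable {k : Type*} [Field k] {d : FreeAlgebra k (Fin 3) →ₗ[k] FreeAlgebra k (Fin 3)}

theorem map_ι_two_mul (hd : IsKoszulCYDifferential k d) (u : FreeAlgebra k (Fin 3)) :
    d (ι k 2 * u) = -(ι k 2 * d u) := by
  rw [hd.isDG.map_ι_mul, hd.map_ι_two, zero_mul, zero_sub]

theorem map_ι_zero_mul (hd : IsKoszulCYDifferential k d) (u : FreeAlgebra k (Fin 3)) :
    d (ι k 0 * u) = ι k 2 * (ι k 2 * u) - ι k 0 * d u := by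
  rw [hd.isDG.map_ι_mul, hd.map_ι_zero, mul_assoc]

theorem map_ι_one_mul (hd : IsKoszulCYDifferential k d) (u : FreeAlgebra k (Fin 3)) :
    d (ι k 1 * u) = ι k 0 * (ι k 2 * u) + ι k 2 * (ι k 0 * u) - ι k 1 * d u := by
  rw [hd.isDG.map_ι_mul, hd.map_ι_one, add_mul, mul_assoc, mul_assoc]

/-- The differential in the decomposition `A = k ⊕ x3 A ⊕ x1 A ⊕ x2 A`. -/
theorem map_ι_mul_sum (hd : IsKoszulCYDifferential k d) (p q r : FreeAlgebra k (Fin 3)) :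
    d (ι k 2 * p + ι k 0 * q + ι k 1 * r) =
      ι k 2 * (ι k 2 * q + ι k 0 * r - d p) + ι k 0 * (ι k 2 * r - d q) + ι k 1 * (-d r) := by
  rw [map_add, map_add, hd.map_ι_two_mul, hd.map_ι_zero_mul, hd.map_ι_one_mul]
  simp only [mul_add, mul_sub, mul_neg]
  abel

theorem wElt_mul (u : FreeAlgebra k (Fin 3)) :
    wElt k * u = ι k 2 * (ι k 1 * u) + ι k 0 * (ι k 0 * u) + ι k 1 * (ι k 2 * u) := by
  simp only [wElt, add_mul, mul_assoc]
  abel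

theorem map_wElt_pow (hd : IsKoszulCYDifferential k d) (n : ℕ) : d (wElt k ^ n) = 0 := by
  induction n with
  | zero => simpa using hd.isDG.map_one
  | succ n ih =>
    rw [pow_succ', wElt_mul, hd.map_ι_mul_sum, hd.map_ι_two_mul, hd.map_ι_zero_mul,
      hd.map_ι_one_mul, ih]
    simp only [mul_zero, sub_zero, neg_zero]
    rw [add_comm (ι k 2 * (ι k 0 * wElt k ^ n)), sub_self]
    simp

theorem map_ι_two_mul_wElt_pow (hd : IsKoszulCYDifferential k d) (n : ℕ) :
    d (ι k 2 * wElt k ^ n) = 0 := by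
  rw [hd.map_ι_two_mul, hd.map_wElt_pow, mul_zero, neg_zero]

theorem eq_zero_of_map_eq_add_smul {h v x : FreeAlgebra k (Fin 3)} {c : k}
    (hh : h ∉ LinearMap.range d) (H : d x = d v + c • h) : c = 0 := by
  by_contra hc
  refine hh ⟨c⁻¹ • (x - v), ?_⟩
  rw [map_smul, map_sub, H, add_sub_cancel_left, smul_smul, inv_mul_cancel₀ hc, one_smul]

theorem ι_two_mul_wElt_pow_mem (n : ℕ) : ι k 2 * wElt k ^ n ∈ Vgen k ^ (2 * n + 1) :=
  ι_mul_mem 2 (wElt_pow_mem n)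

theorem cyclesSpannedBy_zero : CyclesSpannedBy d 0 (1 : FreeAlgebra k (Fin 3)) := by
  intro u hu _
  rw [pow_zero] at hu
  obtain ⟨c, rfl⟩ := Submodule.mem_one.mp hu
  exact ⟨0, by simp, c, by simp [Algebra.algebraMap_eq_smul_one]⟩

theorem ι_two_notMem_range (hd : IsKoszulCYDifferential k d) : ι k 2 ∉ LinearMap.range d := by
  intro h
  obtain ⟨v, hv, hv'⟩ := exists_homogeneous_preimage hd.isDG.1 (m := 0)
    (by simpa using ι_mem_Vgen 2) h
  rw [pow_zero] at hv
  obtain ⟨c, rfl⟩ := Submodule.mem_one.mp hv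
  rw [Algebra.algebraMap_eq_smul_one, map_smul, hd.isDG.map_one, smul_zero] at hv'
  exact ι_ne_zero 2 hv'.symm

theorem cyclesSpannedBy_odd (hd : IsKoszulCYDifferential k d) {n : ℕ}
    (H : CyclesSpannedBy d (2 * n) (wElt k ^ n))
    (hn : ι k 2 * wElt k ^ n ∉ LinearMap.range d) :
    CyclesSpannedBy d (2 * n + 1) (ι k 2 * wElt k ^ n) := by
  refine .of_exists hd.isDG (ι_two_mul_wElt_pow_mem n) fun u hu hu0 => ?_
  obtain ⟨p, hp, q, hq, r, hr, rfl⟩ := exists_of_mem_Vgen_pow_succ hu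
  rw [hd.map_ι_mul_sum] at hu0
  obtain ⟨hp0, hq0, hr0⟩ := ι_mul_sum_inj (hu0.trans (by simp :
    (0 : FreeAlgebra k (Fin 3)) = ι k 2 * 0 + ι k 0 * 0 + ι k 1 * 0))
  rw [sub_eq_zero] at hp0 hq0
  obtain ⟨v, hv, c, rfl⟩ := H r hr (neg_eq_zero.mp hr0)
  obtain rfl : c = 0 := eq_zero_of_map_eq_add_smul (v := -(ι k 2 * v)) (x := q) hn <| by
    rw [← hq0, map_neg, hd.map_ι_two_mul, mul_add, mul_smul_comm, neg_neg]
  rw [zero_smul, add_zero] at hq0 hp0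
  obtain ⟨v', hv', c', hc'⟩ := H (q + ι k 2 * v) (add_mem hq (hv 2)) (by
    rw [map_add, hd.map_ι_two_mul, hq0, add_neg_cancel])
  obtain rfl := eq_sub_of_add_eq hc'
  obtain rfl : c' = 0 := eq_zero_of_map_eq_add_smul (v := -(ι k 0 * v) - ι k 2 * v') (x := p)
    hn <| by
    rw [← hp0, map_sub, map_neg, hd.map_ι_two_mul, hd.map_ι_zero_mul]
    simp only [mul_add, mul_sub, mul_smul_comm]
    abel
  rw [zero_smul, add_zero] at hp0
  obtain ⟨v'', -, c'', hc''⟩ := H (p + ι k 0 * v + ι k 2 * v')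
    (add_mem (add_mem hp (hv 0)) (hv' 2)) (by
      rw [map_add, map_add, hd.map_ι_two_mul, hd.map_ι_zero_mul, ← hp0, mul_sub]; abel)
  obtain rfl := eq_sub_of_add_eq (eq_sub_of_add_eq hc'')
  refine ⟨-(ι k 2 * v'' + ι k 0 * v' + ι k 1 * v), c'', ?_⟩
  rw [map_neg, hd.map_ι_mul_sum]
  simp only [mul_add, mul_sub, mul_neg, mul_smul_comm, zero_smul, add_zero]
  abel

/-- A pair `q`, `r` of elements of odd degree with `d r = 0` and `d q = x3 * r` is standard up to
boundaries, and `x3 * q + x1 * r` is then a boundary. -/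
theorem exists_of_odd_cycle (hd : IsKoszulCYDifferential k d) {n : ℕ}
    (H : CyclesSpannedBy d (2 * n + 1) (ι k 2 * wElt k ^ n)) {q r : FreeAlgebra k (Fin 3)}
    (hq : q ∈ Vgen k ^ (2 * n + 1)) (hr : r ∈ Vgen k ^ (2 * n + 1)) (hr0 : d r = 0)
    (hq0 : d q = ι k 2 * r) :
    ∃ v, (∀ i, ι k i * v ∈ Vgen k ^ (2 * n + 1)) ∧ ∃ v', (∀ i, ι k i * v' ∈ Vgen k ^ (2 * n + 1)) ∧
      ∃ c c' : k, r = d v + c • (ι k 2 * wElt k ^ n) ∧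
        q = d v' + c' • (ι k 2 * wElt k ^ n) + c • (ι k 0 * wElt k ^ n) - ι k 2 * v ∧
        ι k 2 * q + ι k 0 * r = d (c' • (ι k 0 * wElt k ^ n) + c • (ι k 1 * wElt k ^ n)
          - ι k 0 * v - ι k 2 * v') := by
  obtain ⟨v, hv, c, rfl⟩ := H r hr hr0
  obtain ⟨v', hv', c', hc'⟩ := H (q + ι k 2 * v - c • (ι k 0 * wElt k ^ n))
    (sub_mem (add_mem hq (hv 2)) (Submodule.smul_mem _ _ (ι_mul_mem 0 (wElt_pow_mem n)))) (by
      rw [map_sub, map_add, map_smul, hd.map_ι_two_mul, hd.map_ι_zero_mul, hq0,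
        hd.map_wElt_pow, mul_zero, sub_zero, mul_add, mul_smul_comm]
      abel)
  obtain rfl := eq_sub_of_add_eq (eq_add_of_sub_eq hc')
  refine ⟨v, hv, v', hv', c, c', rfl, rfl, ?_⟩
  simp only [map_add, map_sub, map_smul, hd.map_ι_two_mul, hd.map_ι_zero_mul, hd.map_ι_one_mul,
    hd.map_wElt_pow, mul_zero, sub_zero, mul_add, mul_sub, mul_smul_comm, smul_add]
  abel

theorem cyclesSpannedBy_even (hd : IsKoszulCYDifferential k d) {n : ℕ}
    (H : CyclesSpannedBy d (2 * n + 1) (ι k 2 * wElt k ^ n)) :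
    CyclesSpannedBy d (2 * (n + 1)) (wElt k ^ (n + 1)) := by
  refine .of_exists hd.isDG (m := 2 * n + 1) (wElt_pow_mem (n + 1)) fun u hu hu0 => ?_
  obtain ⟨p, hp, q, hq, r, hr, rfl⟩ := exists_of_mem_Vgen_pow_succ hu
  rw [hd.map_ι_mul_sum] at hu0
  obtain ⟨hp0, hq0, hr0⟩ := ι_mul_sum_inj (hu0.trans (by simp :
    (0 : FreeAlgebra k (Fin 3)) = ι k 2 * 0 + ι k 0 * 0 + ι k 1 * 0))
  rw [sub_eq_zero] at hp0 hq0
  obtain ⟨v, hv, v', hv', c, c', rfl, hq', hsum⟩ :=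
    hd.exists_of_odd_cycle H hq hr (neg_eq_zero.mp hr0) hq0.symm
  have hw (i : Fin 3) := ι_mul_mem i (wElt_pow_mem (k := k) n)
  obtain ⟨v'', -, c'', hc''⟩ := H (p - (c' • (ι k 0 * wElt k ^ n) + c • (ι k 1 * wElt k ^ n)
      - ι k 0 * v - ι k 2 * v'))
    (sub_mem hp (sub_mem (sub_mem (add_mem
      (Submodule.smul_mem _ _ (hw 0))
      (Submodule.smul_mem _ _ (hw 1))) (hv 0)) (hv' 2)))
    (by rw [map_sub, ← hsum, hp0, sub_self])
  obtain rfl := eq_add_of_sub_eq hc''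
  refine ⟨c' • (ι k 1 * wElt k ^ n) + c'' • (ι k 0 * wElt k ^ n)
    - (ι k 2 * v'' + ι k 0 * v' + ι k 1 * v), c, ?_⟩
  rw [hq', map_sub, hd.map_ι_mul_sum, pow_succ', wElt_mul]
  simp only [map_add, map_smul, hd.map_ι_zero_mul, hd.map_ι_one_mul,
    hd.map_wElt_pow, mul_zero, sub_zero, mul_add, mul_sub, mul_neg, mul_smul_comm, smul_add]
  abel

theorem wElt_pow_succ_notMem_range (hd : IsKoszulCYDifferential k d) {n : ℕ}
    (hn : ι k 2 * wElt k ^ n ∉ LinearMap.range d) : wElt k ^ (n + 1) ∉ LinearMap.range d := by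
  intro h
  obtain ⟨u, hu, hu0⟩ := exists_homogeneous_preimage hd.isDG.1 (m := 2 * n + 1)
    (wElt_pow_mem (n + 1)) h
  obtain ⟨p, hp, q, hq, r, hr, rfl⟩ := exists_of_mem_Vgen_pow_succ hu
  rw [hd.map_ι_mul_sum, pow_succ', wElt_mul] at hu0
  exact hn ⟨-r, by rw [map_neg, (ι_mul_sum_inj hu0).2.2]⟩

theorem ι_two_mul_wElt_pow_succ_notMem_range (hd : IsKoszulCYDifferential k d) {n : ℕ}
    (H : CyclesSpannedBy d (2 * n + 1) (ι k 2 * wElt k ^ n))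
    (hn : wElt k ^ (n + 1) ∉ LinearMap.range d) :
    ι k 2 * wElt k ^ (n + 1) ∉ LinearMap.range d := by
  intro h
  obtain ⟨u, hu, hu0⟩ := exists_homogeneous_preimage hd.isDG.1
    (ι_two_mul_wElt_pow_mem (n + 1)) h
  obtain ⟨p, hp, q, hq, r, hr, rfl⟩ := exists_of_mem_Vgen_pow_succ (m := 2 * n + 1) hu
  rw [hd.map_ι_mul_sum] at hu0
  obtain ⟨hp0, hq0, hr0⟩ := ι_mul_sum_inj (hu0.trans (by simp :
    _ = ι k 2 * wElt k ^ (n + 1) + ι k 0 * 0 + ι k 1 * 0))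
  rw [sub_eq_zero] at hq0
  obtain ⟨_, _, _, _, _, _, _, _, hsum⟩ :=
    hd.exists_of_odd_cycle H hq hr (neg_eq_zero.mp hr0) hq0.symm
  rw [hsum, ← map_sub] at hp0
  exact hn ⟨_, hp0⟩

theorem cyclesSpannedBy_and_notMem_range (hd : IsKoszulCYDifferential k d) (n : ℕ) :
    CyclesSpannedBy d (2 * n) (wElt k ^ n) ∧ ι k 2 * wElt k ^ n ∉ LinearMap.range d := by
  induction n with
  | zero => exact ⟨by simpa using cyclesSpannedBy_zero, by simpa using hd.ι_two_notMem_range⟩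
  | succ n ih =>
    have H := hd.cyclesSpannedBy_odd ih.1 ih.2
    exact ⟨hd.cyclesSpannedBy_even H,
      hd.ι_two_mul_wElt_pow_succ_notMem_range H (hd.wElt_pow_succ_notMem_range ih.2)⟩

end IsKoszulCYDifferential

/-- Suppose `d` is a differential on `A` with `d x1 = x3*x3`,
`d x2 = x1*x3 + x3*x1` and `d x3 = 0`, and set `w := x1*x1 + x2*x3 + x3*x2`. Then for every
`n ≥ 1`: `ker d ∩ A_{2n−1} = (range d ∩ A_{2n−1}) + k·(x3*w^{n−1})` and
`x3*w^{n−1} ∉ range d`; and for every `n ≥ 0`: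
`ker d ∩ A_{2n} = (range d ∩ A_{2n}) + k·w^n`, with `w^n ∉ range d` for `n ≥ 1`.
(Equivalently, `H(A, d) ≅ k[⌈x3⌉,⌈w⌉]/(⌈x3⌉²)`.) -/
theorem cohomology_of_dgfree_koszul_CY (k : Type*) [Field k] [CharZero k]
    (d : FreeAlgebra k (Fin 3) →ₗ[k] FreeAlgebra k (Fin 3))
    (hd : IsDGDifferential k d)
    (hx1 : d (FreeAlgebra.ι k 0) = FreeAlgebra.ι k 2 * FreeAlgebra.ι k 2)
    (hx2 : d (FreeAlgebra.ι k 1) =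
      FreeAlgebra.ι k 0 * FreeAlgebra.ι k 2 + FreeAlgebra.ι k 2 * FreeAlgebra.ι k 0)
    (hx3 : d (FreeAlgebra.ι k 2) = 0) :
    (∀ n : ℕ, 1 ≤ n →
      LinearMap.ker d ⊓ (Vgen k) ^ (2 * n - 1) =
        (LinearMap.range d ⊓ (Vgen k) ^ (2 * n - 1)) ⊔
          Submodule.span k {FreeAlgebra.ι k 2 * wElt k ^ (n - 1)}) ∧
    (∀ n : ℕ, 1 ≤ n →
      FreeAlgebra.ι k 2 * wElt k ^ (n - 1) ∉ LinearMap.range d) ∧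
    (∀ n : ℕ,
      LinearMap.ker d ⊓ (Vgen k) ^ (2 * n) =
        (LinearMap.range d ⊓ (Vgen k) ^ (2 * n)) ⊔ Submodule.span k {wElt k ^ n}) ∧
    (∀ n : ℕ, 1 ≤ n → wElt k ^ n ∉ LinearMap.range d) := by
  have H : IsKoszulCYDifferential k d := ⟨hd, hx1, hx2, hx3⟩
  refine ⟨fun n hn => ?_, fun n _ => (H.cyclesSpannedBy_and_notMem_range (n - 1)).2, fun n => ?_,
    fun n hn => ?_⟩
  · obtain ⟨n, rfl⟩ := Nat.exists_eq_add_of_le' hn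
    obtain ⟨hc, hr⟩ := H.cyclesSpannedBy_and_notMem_range n
    exact (H.cyclesSpannedBy_odd hc hr).ker_inf_eq hd
      (IsKoszulCYDifferential.ι_two_mul_wElt_pow_mem n)
      (H.map_ι_two_mul_wElt_pow n)
  · exact (H.cyclesSpannedBy_and_notMem_range n).1.ker_inf_eq hd (FreeAlgebra.wElt_pow_mem n)
      (H.map_wElt_pow n)
  · obtain ⟨n, rfl⟩ := Nat.exists_eq_add_of_le' hn
    exact H.wElt_pow_succ_notMem_range (H.cyclesSpannedBy_and_notMem_range n).2
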